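/- Let D̄ be a closed disc in ℂ with centre 0 and let F : D̄ → ℂ be of Hölder class C^α(D̄) with 0 < α < 1. Assume there exist a nowhere-dense subset E ⊂ D̄ and constants K > 0, ν ≥ 1 such that for each ζ ∈ D̄ \ E there exists a constant C_ζ with |C_ζ| = 1 such that C_ζ·(z − ζ)·(F(z) − F(ζ)) ∈ W(K, ν) for all z ∈ D̄. Then Graph_{D̄}(F) is polynomially convex. -/

import Mathlib

open Complex Metric

noncomputable def pEval (x : ℂ × ℂ) (p : MvPolynomial (Fin 2) ℂ) : ℂ :=
  MvPolynomial.eval ![x.1, x.2] p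

/-- The polynomially convex hull of a set in `ℂ²`. -/
noncomputable def polyHull (X : Set (ℂ × ℂ)) : Set (ℂ × ℂ) :=
  {x | ∀ p : MvPolynomial (Fin 2) ℂ, ‖pEval x p‖ ≤ ⨆ y ∈ X, ‖pEval y p‖}

def IsPolyConvex (X : Set (ℂ × ℂ)) : Prop := polyHull X = X

def graphOn (S : Set ℂ) (F : ℂ → ℂ) : Set (ℂ × ℂ) := {q | q.1 ∈ S ∧ q.2 = F q.1}

def HolderOn (F : ℂ → ℂ) (α : ℝ) (S : Set ℂ) : Prop :=
  ∃ c : ℝ, 0 ≤ c ∧ ∀ z ∈ S, ∀ w ∈ S, ‖F z - F w‖ ≤ c * ‖z - w‖ ^ α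

/-- The wedge `W(K, ν) = {u + iv : u ≥ 0, |v| ≤ K u^{1/ν}}`. -/
noncomputable def wedge (K ν : ℝ) : Set ℂ :=
  {w : ℂ | 0 ≤ w.re ∧ |w.im| ≤ K * w.re ^ (1 / ν)}

theorem norm_pEval_le_of_mem_polyHull {X : Set (ℂ × ℂ)} {x : ℂ × ℂ} (hx : x ∈ polyHull X)
    (p : MvPolynomial (Fin 2) ℂ) {B : ℝ} (hB : 0 ≤ B) (h : ∀ y ∈ X, ‖pEval y p‖ ≤ B) :
    ‖pEval x p‖ ≤ B :=
  (hx p).trans (Real.iSup_le (fun y => Real.iSup_le (fun hy => h y hy) hB) hB)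

theorem continuous_pEval (p : MvPolynomial (Fin 2) ℂ) : Continuous fun x => pEval x p := by
  unfold pEval
  refine (MvPolynomial.continuous_eval p).comp (continuous_pi fun i => ?_)
  fin_cases i
  · exact continuous_fst
  · exact continuous_snd

theorem subset_polyHull {X : Set (ℂ × ℂ)} (hX : IsCompact X) : X ⊆ polyHull X := by
  intro x hx p
  obtain ⟨B, hB⟩ := hX.exists_bound_of_continuousOn (continuous_pEval p).continuousOn
  have hB0 : 0 ≤ B := (norm_nonneg _).trans (hB x hx)
  have hbdd : BddAbove (Set.range fun y => ⨆ _ : y ∈ X, ‖pEval y p‖) := by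
    refine ⟨B, ?_⟩
    rintro _ ⟨y, rfl⟩
    exact Real.iSup_le (fun hy => hB y hy) hB0
  refine le_trans ?_ (le_ciSup hbdd x)
  have : Nonempty (x ∈ X) := ⟨hx⟩
  exact (ciSup_const).ge

theorem isCompact_graphOn {S : Set ℂ} {F : ℂ → ℂ} (hS : IsCompact S) (hF : ContinuousOn F S) :
    IsCompact (graphOn S F) := by
  have : graphOn S F = (fun z => (z, F z)) '' S := by
    ext ⟨a, b⟩
    simp only [graphOn, Set.mem_ofPred_eq, Set.mem_image, Prod.mk.injEq]
    exact ⟨fun ⟨h, e⟩ => ⟨a, h, rfl, e.symm⟩, fun ⟨z, h, e, e'⟩ => by subst e; exact ⟨h, e'.symm⟩⟩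
  rw [this]
  exact hS.image_of_continuousOn (continuousOn_id.prodMk hF)

theorem HolderOn.continuousOn {F : ℂ → ℂ} {α : ℝ} {S : Set ℂ} (h : HolderOn F α S)
    (hα : 0 < α) : ContinuousOn F S := by
  obtain ⟨c, -, hc⟩ := h
  intro w hw
  rw [ContinuousWithinAt, tendsto_iff_norm_sub_tendsto_zero]
  have hlim : Filter.Tendsto (fun z : ℂ => c * ‖z - w‖ ^ α) (nhdsWithin w S) (nhds 0) := by
    have hcont : Continuous fun z : ℂ => c * ‖z - w‖ ^ α :=
      continuous_const.mul ((by fun_prop : Continuous fun z : ℂ => ‖z - w‖).rpow_const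
        fun _ => Or.inr hα.le)
    have := (hcont.tendsto w).mono_left (nhdsWithin_le_nhds (s := S))
    simpa [Real.zero_rpow hα.ne'] using this
  exact squeeze_zero' (Filter.Eventually.of_forall fun _ => norm_nonneg _)
    (Filter.mem_of_superset self_mem_nhdsWithin fun z hz => hc z hz w hw) hlim

theorem isClosed_wedge (K : ℝ) {ν : ℝ} (hν : 0 ≤ ν) : IsClosed (wedge K ν) := by
  refine (isClosed_le continuous_const continuous_re).inter
    (isClosed_le continuous_im.abs (continuous_const.mul ?_))
  exact continuous_re.rpow_const fun _ => Or.inr (by positivity)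

theorem eq_zero_of_mem_wedge {K ν : ℝ} (hν : 0 < ν) {w : ℂ} (hw : w ∈ wedge K ν)
    (h : w.re = 0) : w = 0 := by
  have him := hw.2
  rw [h, Real.zero_rpow (by positivity), mul_zero] at him
  exact Complex.ext h (abs_nonpos_iff.mp him)

theorem closedBall_subset_closure_diff {r : ℝ} (hr : r ≠ 0) {E : Set ℂ}
    (hE : IsNowhereDense E) : closedBall (0 : ℂ) r ⊆ closure (closedBall 0 r \ E) := by
  have hd : Dense (closure E)ᶜ := interior_eq_empty_iff_dense_compl.mp hE
  rw [← closure_ball (0 : ℂ) hr]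
  refine closure_minimal ((hd.open_subset_closure_inter isOpen_ball).trans
    (closure_mono fun z hz => ⟨subset_closure hz.1, fun h => hz.2 (subset_closure h)⟩))
    isClosed_closure

/-- A rotation condition holding at the points of a set `T` persists on its closure. -/
theorem exists_rotation_of_mem_closure {S T W : Set ℂ} {F : ℂ → ℂ} (hF : ContinuousOn F S)
    (hTS : T ⊆ S) (hW : IsClosed W)
    (h : ∀ ζ ∈ T, ∃ C : ℂ, ‖C‖ = 1 ∧ ∀ z ∈ S, C * (z - ζ) * (F z - F ζ) ∈ W)
    {ζ : ℂ} (hζ : ζ ∈ S) (hζT : ζ ∈ closure T) :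
    ∃ C : ℂ, ‖C‖ = 1 ∧ ∀ z ∈ S, C * (z - ζ) * (F z - F ζ) ∈ W := by
  obtain ⟨u, huT, hu⟩ := mem_closure_iff_seq_limit.mp hζT
  choose C hC hCW using fun n => h (u n) (huT n)
  obtain ⟨C', hC', φ, hφ, hlim⟩ := (isCompact_sphere (0 : ℂ) 1).tendsto_subseq
    (x := C) (fun n => by simp [hC n])
  refine ⟨C', by simpa using hC', fun z hz => ?_⟩
  have hu' := hu.comp hφ.tendsto_atTop
  have hFu : Filter.Tendsto (fun n => F (u (φ n))) Filter.atTop (nhds (F ζ)) :=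
    (hF ζ hζ).tendsto.comp (tendsto_nhdsWithin_iff.mpr
      ⟨hu', Filter.Eventually.of_forall fun n => hTS (huT _)⟩)
  exact hW.mem_of_tendsto
    ((hlim.mul (tendsto_const_nhds.sub hu')).mul (tendsto_const_nhds.sub hFu))
    (Filter.Eventually.of_forall fun n => hCW (φ n) z hz)

theorem norm_one_sub_div_pow_le {q : ℂ} (hq : ‖q‖ ≤ 1) {m : ℕ} (hm : 0 < m) :
    ‖(1 - q / m) ^ (m ^ 2)‖ ≤ 2 * Real.exp (-(m * q.re)) := by
  have hm' : (0 : ℝ) < m := by exact_mod_cast hm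
  have h1 : ‖1 - q / m‖ ^ 2 ≤ Real.exp (-2 * q.re / m + 1 / m ^ 2) := by
    have hsq : ‖1 - q / m‖ ^ 2 = 1 - 2 * q.re / m + ‖q‖ ^ 2 / m ^ 2 := by
      rw [← Complex.normSq_eq_norm_sq, ← Complex.normSq_eq_norm_sq, Complex.normSq_apply,
        Complex.normSq_apply]
      simp only [Complex.sub_re, Complex.sub_im, Complex.one_re, Complex.one_im,
        Complex.div_natCast_re, Complex.div_natCast_im]
      field_simp
      ring
    rw [hsq]
    have h2 : ‖q‖ ^ 2 / (m : ℝ) ^ 2 ≤ 1 / m ^ 2 := by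
      gcongr
      exact pow_le_one₀ (norm_nonneg _) hq
    have h3 := Real.add_one_le_exp (-2 * q.re / m + 1 / (m : ℝ) ^ 2)
    have h4 : -2 * q.re / (m : ℝ) = -(2 * q.re / m) := by ring
    linarith
  refine le_of_sq_le_sq ?_ (by positivity)
  rw [norm_pow, ← pow_mul, mul_comm (m ^ 2) 2, pow_mul]
  calc (‖1 - q / m‖ ^ 2) ^ (m ^ 2)
      ≤ Real.exp (-2 * q.re / m + 1 / m ^ 2) ^ (m ^ 2) := by gcongr
    _ = Real.exp 1 * Real.exp (-(m * q.re)) ^ 2 := by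
        rw [← Real.exp_nat_mul, ← Real.exp_nat_mul, ← Real.exp_add]
        congr 1
        push_cast
        field_simp
        ring
    _ ≤ (2 * Real.exp (-(m * q.re))) ^ 2 := by
        have := Real.exp_one_lt_d9
        rw [mul_pow]
        gcongr
        linarith

/-- If the polynomial `q` maps the compact set `X` to the right half-plane, and `g` vanishes
wherever `re q` does on `X`, then `g` vanishes on the zeros of `q` in the hull of `X`. -/
theorem pEval_eq_zero_of_mem_polyHull {X : Set (ℂ × ℂ)} (hX : IsCompact X)
    (g q : MvPolynomial (Fin 2) ℂ) (hq : ∀ y ∈ X, 0 ≤ (pEval y q).re)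
    (hg : ∀ y ∈ X, (pEval y q).re = 0 → pEval y g = 0) {x : ℂ × ℂ} (hx : x ∈ polyHull X)
    (hqx : pEval x q = 0) : pEval x g = 0 := by
  by_contra hne
  have hd : 0 < ‖pEval x g‖ := norm_pos_iff.mpr hne
  set d := ‖pEval x g‖ with hd_def
  obtain ⟨M, hM⟩ := hX.exists_bound_of_continuousOn (continuous_pEval q).continuousOn
  obtain ⟨G, hG⟩ := hX.exists_bound_of_continuousOn (continuous_pEval g).continuousOn
  obtain ⟨δ, hδ, hδle⟩ := (hX.inter_right (isClosed_le continuous_const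
    (continuous_pEval g).norm : IsClosed {y | d / 4 ≤ ‖pEval y g‖})).exists_forall_le'
    (continuous_re.comp (continuous_pEval q)).continuousOn (a := 0) (fun y hy => by
      refine lt_of_le_of_ne (hq y hy.1) fun h => ?_
      have h0 := hg y hy.1 h.symm
      have := hy.2
      simp only [Set.mem_ofPred_eq, h0, norm_zero] at this
      linarith)
  set t : ℝ := 1 / (|M| + 1) with ht
  have htpos : 0 < t := by positivity
  have htM : ∀ y ∈ X, ‖(t : ℂ) * pEval y q‖ ≤ 1 := fun y hy => by
    rw [norm_mul, Complex.norm_real, Real.norm_of_nonneg htpos.le, ht, one_div_mul_eq_div,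
      div_le_one (by positivity)]
    linarith [hM y hy, le_abs_self M]
  obtain ⟨m, hm0, hm⟩ : ∃ m : ℕ, 0 < m ∧
      |G| * (2 * Real.exp (-(m * (t * δ)))) < d / 2 := by
    have h1 : Filter.Tendsto (fun m : ℕ => |G| * (2 * Real.exp (-(m * (t * δ))))) Filter.atTop
        (nhds (|G| * (2 * 0))) := by
      refine Filter.Tendsto.const_mul _ (Filter.Tendsto.const_mul _ ?_)
      exact Real.tendsto_exp_neg_atTop_nhds_zero.comp
        (tendsto_natCast_atTop_atTop.atTop_mul_const (by positivity))
    exact ((Filter.eventually_gt_atTop 0).and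
      (h1.eventually_lt_const (by simpa using hd))).exists
  set f : MvPolynomial (Fin 2) ℂ :=
    g * (1 - MvPolynomial.C ((t : ℂ) / m) * q) ^ (m ^ 2)
  have hf : ∀ y, pEval y f = pEval y g * (1 - (t * pEval y q) / m) ^ (m ^ 2) := fun y => by
    simp only [f, pEval, map_mul, map_pow, map_sub, map_one, MvPolynomial.eval_C]
    ring
  have hle := norm_pEval_le_of_mem_polyHull hx f (B := d / 2) (by positivity) fun y hy => by
    have hb := norm_one_sub_div_pow_le (htM y hy) hm0
    rw [Complex.re_ofReal_mul] at hb
    rw [hf, norm_mul]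
    by_cases hy4 : d / 4 ≤ ‖pEval y g‖
    · have hδy : δ ≤ (pEval y q).re := hδle y ⟨hy, hy4⟩
      refine le_trans (mul_le_mul ((hG y hy).trans (le_abs_self G)) (hb.trans ?_)
        (norm_nonneg _) (abs_nonneg _)) hm.le
      gcongr
    · have h2 : Real.exp (-(m * (t * (pEval y q).re))) ≤ 1 :=
        Real.exp_le_one_iff.mpr (neg_nonpos.mpr
          (mul_nonneg m.cast_nonneg (mul_nonneg htpos.le (hq y hy))))
      calc _ ≤ d / 4 * 2 := mul_le_mul (not_le.mp hy4).le (by linarith) (norm_nonneg _)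
            (by positivity)
        _ = d / 2 := by ring
  rw [hf, hqx, mul_zero, zero_div, sub_zero, one_pow, mul_one] at hle
  linarith

/-- Proposition 1.3 (first part): the graph of `F` over the closed disc is
polynomially convex. -/
theorem holder_graph_polyConvex_simple (r α K ν : ℝ) (hr : 0 < r)
    (hα0 : 0 < α) (hα1 : α < 1)
    (F : ℂ → ℂ) (E : Set ℂ)
    (hF : HolderOn F α (closedBall 0 r))
    (hE : E ⊆ closedBall 0 r) (hEnd : IsNowhereDense E)
    (hK : 0 < K) (hν : 1 ≤ ν)
    (hyp : ∀ ζ ∈ closedBall (0 : ℂ) r \ E,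
      ∃ C : ℂ, ‖C‖ = 1 ∧
        ∀ z ∈ closedBall (0 : ℂ) r,
          C * (z - ζ) * (F z - F ζ) ∈ wedge K ν) :
    IsPolyConvex (graphOn (closedBall 0 r) F) := by
  have hcont := hF.continuousOn hα0
  have hX := isCompact_graphOn (isCompact_closedBall (0 : ℂ) r) hcont
  refine Set.Subset.antisymm ?_ (subset_polyHull hX)
  rintro ⟨ζ, b⟩ hx
  have hζ : ζ ∈ closedBall (0 : ℂ) r := by
    have := norm_pEval_le_of_mem_polyHull hx (MvPolynomial.X 0) hr.le
      fun y hy => by simpa [pEval] using hy.1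
    simpa [pEval] using this
  refine ⟨hζ, ?_⟩
  obtain ⟨C, hC, hCW⟩ := exists_rotation_of_mem_closure hcont Set.sdiff_subset
    (isClosed_wedge K (by linarith : 0 ≤ ν)) hyp hζ
    (closedBall_subset_closure_diff hr.ne' hEnd hζ)
  have hC0 : C ≠ 0 := norm_ne_zero_iff.mp (by simp [hC])
  set g : MvPolynomial (Fin 2) ℂ := MvPolynomial.X 1 - MvPolynomial.C (F ζ)
  set q : MvPolynomial (Fin 2) ℂ :=
    MvPolynomial.C C * (MvPolynomial.X 0 - MvPolynomial.C ζ) * g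
  have hg : ∀ y, pEval y g = y.2 - F ζ := fun y => by simp [g, pEval]
  have hq : ∀ y, pEval y q = C * (y.1 - ζ) * (y.2 - F ζ) := fun y => by simp [q, g, pEval]
  have hmem : ∀ y ∈ graphOn (closedBall 0 r) F, pEval y q ∈ wedge K ν := fun y hy => by
    rw [hq, hy.2]
    exact hCW y.1 hy.1
  have hzero := pEval_eq_zero_of_mem_polyHull hX g q (fun y hy => (hmem y hy).1)
    (fun y hy h => by
      have h0 := eq_zero_of_mem_wedge (by linarith) (hmem y hy) h
      rw [hq, mul_eq_zero, mul_eq_zero] at h0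
      rw [hg]
      rcases h0 with (h0 | h0) | h0
      · exact absurd h0 hC0
      · rw [hy.2, sub_eq_zero.mp h0, sub_self]
      · exact h0) hx (by rw [hq]; simp)
  rw [hg] at hzero
  exact sub_eq_zero.mp hzero
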